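/- Let (Ω₁^k × Ω₂^k, μ) be a finite correlated probability space such that the marginal of μ on any pair of coordinates, one from the Ω₁^k block and one from the Ω₂^k block, is a product distribution; assume further that all k coordinate-marginals of μ on the Ω₁ side are equal to a common distribution ν₁ and all k coordinate-marginals on the Ω₂ side are equal to ν₂. Let μ₁, μ₂ be the marginals of μ on Ω₁^k and Ω₂^k. Let X, Y be random k × L matrices chosen by drawing, independently for each i ∈ [L], the column pair (x^i, y^i) ∈ Ω₁^k × Ω₂^k from μ, and let x_1, …, x_k and y_1, …, y_k denote the rows of X and Y. Let F : Ω₁^L → [−1, 1] and G : Ω₂^L → [−1, 1], with influences taken with respect to ν₁^{⊗L} and ν₂^{⊗L} respectively, and set τ := sqrt(Σ_{i∈[L]} Inf_i[F]·Inf_i[G]) and Γ := max{ sqrt(Σ_{i∈[L]} Inf_i[F]), sqrt(Σ_{i∈[L]} Inf_i[G]) }. Then | E_{(X,Y)∼μ^{⊗L}}[ Π_{j=1}^k F(x_j) G(y_j) ] − E_{X∼μ₁^{⊗L}}[ Π_{j=1}^k F(x_j) ] · E_{Y∼μ₂^{⊗L}}[ Π_{j=1}^k G(y_j) ] | ≤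 2^{4k+1} · Γ · τ. -/

import Mathlib

open Finset

section ProductExpectation

variable {ι C D A B : Type*} [Fintype ι] [DecidableEq ι] [Fintype C] [Fintype D]
  [Fintype A] [Fintype B]

/-- Expectation of `Φ` when the coordinates are drawn independently with weights `w i`. -/
def prodExpect (w : ι → C → ℝ) (Φ : (ι → C) → ℝ) : ℝ :=
  ∑ c, (∏ i, w i (c i)) * Φ c

lemma sum_mul_comp_of_fiber [DecidableEq D] (u : C → ℝ) (v : D → ℝ) (π : C → D)
    (h : ∀ d, ∑ c ∈ univ.filter (fun c => π c = d), u c = v d) (Φ : D → ℝ) :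
    ∑ c, u c * Φ (π c) = ∑ d, v d * Φ d := by
  rw [← Finset.sum_fiberwise univ π (fun c => u c * Φ (π c))]
  refine Finset.sum_congr rfl fun d _ => ?_
  rw [← h d, Finset.sum_mul]
  refine Finset.sum_congr rfl fun c hc => ?_
  rw [(Finset.mem_filter.mp hc).2]

lemma prodExpect_comp [DecidableEq D] (w : ι → C → ℝ) (v : D → ℝ) (π : C → D)
    (h : ∀ i d, ∑ c ∈ univ.filter (fun c => π c = d), w i c = v d) (Φ : (ι → D) → ℝ) :
    prodExpect w (fun c => Φ (fun i => π (c i))) = prodExpect (fun _ => v) Φ := by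
  refine sum_mul_comp_of_fiber (fun c : ι → C => ∏ i, w i (c i)) (fun d => ∏ i, v (d i))
    (fun c i => π (c i)) (fun d => ?_) Φ
  have : ∏ i, v (d i) = ∏ i, ∑ c ∈ univ.filter (fun c => π c = d i), w i c :=
    Finset.prod_congr rfl fun i _ => (h i (d i)).symm
  rw [this, Finset.prod_univ_sum]
  refine Finset.sum_congr ?_ fun _ _ => rfl
  ext c
  simp [funext_iff]

lemma prodExpect_prod (u : A → ℝ) (v : B → ℝ) (P : (ι → A) → ℝ) (Q : (ι → B) → ℝ) :
    prodExpect (fun _ z => u z.1 * v z.2)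
        (fun z : ι → A × B => P (fun i => (z i).1) * Q (fun i => (z i).2))
      = prodExpect (fun _ => u) P * prodExpect (fun _ => v) Q := by
  unfold prodExpect
  rw [Finset.sum_mul_sum, ← Finset.sum_product', Finset.univ_product_univ]
  refine Fintype.sum_equiv (Equiv.arrowProdEquivProdArrow ι (fun _ => A) (fun _ => B)) _ _
    fun z => ?_
  simp only [Equiv.arrowProdEquivProdArrow_apply, Finset.prod_mul_distrib]
  ring

lemma prodExpect_update (w : ι → C → ℝ) (i : ι) (u : C → ℝ) (hw : ∑ c, w i c = 1)
    (Φ : (ι → C) → ℝ) :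
    prodExpect (Function.update w i u) Φ
      = prodExpect w (fun c => ∑ a, u a * Φ (Function.update c i a)) := by
  have key (v : ι → C → ℝ) (c : ι → C) :
      ∏ l, v l (c l) = v i (c i) * ∏ l ∈ univ.erase i, v l (c l) :=
    (Finset.mul_prod_erase _ _ (Finset.mem_univ i)).symm
  have hu (c : ι → C) : ∏ l ∈ univ.erase i, Function.update w i u l (c l)
      = ∏ l ∈ univ.erase i, w l (c l) :=
    Finset.prod_congr rfl fun l hl => by rw [Function.update_of_ne (Finset.ne_of_mem_erase hl)]
  have hc (c : ι → C) (a : C) : ∏ l ∈ univ.erase i, w l (Function.update c i a l)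
      = ∏ l ∈ univ.erase i, w l (c l) :=
    Finset.prod_congr rfl fun l hl => by rw [Function.update_of_ne (Finset.ne_of_mem_erase hl)]
  let e : (ι → C) × C ≃ (ι → C) × C :=
    { toFun := fun p => (Function.update p.1 i p.2, p.1 i)
      invFun := fun p => (Function.update p.1 i p.2, p.1 i)
      left_inv := fun p => by simp
      right_inv := fun p => by simp }
  unfold prodExpect
  have hL : ∀ c : ι → C, (∏ l, Function.update w i u l (c l)) * Φ c
      = ∑ a, w i a * (u (c i) * (∏ l ∈ univ.erase i, w l (c l)) * Φ c) := fun c => by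
    rw [← Finset.sum_mul, hw, one_mul, key, hu, Function.update_self]
  simp only [hL, Finset.mul_sum]
  rw [← Finset.sum_product', ← Finset.sum_product', Finset.univ_product_univ]
  refine Fintype.sum_equiv e _ _ fun p => ?_
  simp only [e, Equiv.coe_fn_mk, key w, hc, Function.update_self, Function.update_idem,
    Function.update_eq_self]
  ring

lemma prodExpect_resample (w : ι → C → ℝ) (i : ι) (hw : ∑ c, w i c = 1)
    (Φ : (ι → C) → ℝ) :
    prodExpect w Φ = prodExpect w (fun c => ∑ a, w i a * Φ (Function.update c i a)) := by
  rw [← prodExpect_update w i (w i) hw, Function.update_eq_self]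

lemma prodExpect_update_eq (w : ι → C → ℝ) (i : ι) (u : C → ℝ) (hw : ∑ c, w i c = 1)
    (Φ : (ι → C) → ℝ)
    (h : ∀ c, ∑ a, w i a * Φ (Function.update c i a) = ∑ a, u a * Φ (Function.update c i a)) :
    prodExpect (Function.update w i u) Φ = prodExpect w Φ := by
  rw [prodExpect_update w i u hw, prodExpect_resample w i hw Φ]
  simp only [h]

lemma prodExpect_sum {κ : Type*} (s : Finset κ) (w : ι → C → ℝ) (Φ : κ → (ι → C) → ℝ) :
    prodExpect w (fun c => ∑ b ∈ s, Φ b c) = ∑ b ∈ s, prodExpect w (Φ b) := by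
  unfold prodExpect
  simp only [Finset.mul_sum]
  exact Finset.sum_comm

lemma abs_prodExpect_le (w : ι → C → ℝ) (hw : ∀ i c, 0 ≤ w i c) {Φ a b : (ι → C) → ℝ}
    {K p q : ℝ} (hK : 0 ≤ K) (hΦ : ∀ c, |Φ c| ≤ K * (|a c| * |b c|))
    (ha : prodExpect w (fun c => a c ^ 2) = p) (hb : prodExpect w (fun c => b c ^ 2) = q) :
    |prodExpect w Φ| ≤ K * (√p * √q) := by
  have hW (c : ι → C) : 0 ≤ ∏ i, w i (c i) := Finset.prod_nonneg fun i _ => hw i (c i)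
  have hp : 0 ≤ p := ha ▸ Finset.sum_nonneg fun c _ => mul_nonneg (hW c) (sq_nonneg _)
  have h1 : |prodExpect w Φ| ≤ K * prodExpect w (fun c => |a c| * |b c|) := by
    unfold prodExpect
    rw [Finset.mul_sum]
    refine (Finset.abs_sum_le_sum_abs _ _).trans (Finset.sum_le_sum fun c _ => ?_)
    rw [abs_mul, abs_of_nonneg (hW c), mul_left_comm]
    exact mul_le_mul_of_nonneg_left (hΦ c) (hW c)
  refine h1.trans (mul_le_mul_of_nonneg_left ?_ hK)
  rw [← Real.sqrt_mul hp, ← ha, ← hb]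
  refine Real.le_sqrt_of_sq_le ?_
  refine Finset.sum_sq_le_sum_mul_sum_of_sq_le_mul _
    (fun c _ => mul_nonneg (hW c) (sq_nonneg _)) (fun c _ => mul_nonneg (hW c) (sq_nonneg _))
    fun c _ => le_of_eq ?_
  rw [mul_pow, mul_pow, sq_abs, sq_abs]
  ring

end ProductExpectation

section BoundedProducts

lemma abs_prod_le_of_abs_le_two {κ : Type*} (s : Finset κ) (c : κ → ℝ) (hc : ∀ j, |c j| ≤ 2) :
    |∏ j ∈ s, c j| ≤ 2 ^ s.card := by
  rw [Finset.abs_prod]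
  exact (Finset.prod_le_prod (fun j _ => abs_nonneg _) fun j _ => hc j).trans_eq (by simp)

variable {κ : Type*} [Fintype κ] [DecidableEq κ]

lemma abs_prod_le_one_factor (c : κ → ℝ) (hc : ∀ j, |c j| ≤ 2) (j : κ) :
    |∏ l, c l| ≤ 2 ^ Fintype.card κ / 2 * |c j| := by
  have h := abs_prod_le_of_abs_le_two (univ.erase j) c hc
  have hcard : (univ.erase j).card + 1 = Fintype.card κ :=
    Finset.card_erase_add_one (Finset.mem_univ j)
  rw [← Finset.mul_prod_erase _ _ (Finset.mem_univ j), abs_mul, ← hcard, pow_succ]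
  nlinarith [abs_nonneg (c j)]

lemma abs_prod_le_two_factors (c : κ → ℝ) (hc : ∀ j, |c j| ≤ 2) {j j' : κ} (hj : j' ≠ j) :
    |∏ l, c l| ≤ 2 ^ Fintype.card κ / 4 * (|c j| * |c j'|) := by
  have hmem : j' ∈ univ.erase j := Finset.mem_erase.mpr ⟨hj, Finset.mem_univ _⟩
  have h := abs_prod_le_of_abs_le_two ((univ.erase j).erase j') c hc
  have h1 : (univ.erase j).card + 1 = Fintype.card κ :=
    Finset.card_erase_add_one (Finset.mem_univ j)
  have h2 := Finset.card_erase_add_one hmem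
  rw [← Finset.mul_prod_erase _ _ (Finset.mem_univ j), ← Finset.mul_prod_erase _ _ hmem,
    abs_mul, abs_mul, ← h1, ← h2, pow_succ, pow_succ, ← mul_assoc]
  nlinarith [mul_nonneg (abs_nonneg (c j)) (abs_nonneg (c j'))]

lemma bool_family_trichotomy (β : κ → Bool) :
    (∀ j, β j = false) ∨ (∃ j, β j = true ∧ ∀ j', j' ≠ j → β j' = false) ∨
      ∃ j j', j' ≠ j ∧ β j = true ∧ β j' = true := by
  by_cases h0 : ∃ j, β j = true
  · obtain ⟨j, hj⟩ := h0
    by_cases h1 : ∃ j', j' ≠ j ∧ β j' = true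
    · obtain ⟨j', hne, hj'⟩ := h1
      exact Or.inr (Or.inr ⟨j, j', hne, hj, hj'⟩)
    · refine Or.inr (Or.inl ⟨j, hj, fun j' hne => ?_⟩)
      by_contra h
      exact h1 ⟨j', hne, by simpa using h⟩
  · exact Or.inl fun j => by
      by_contra h
      exact h0 ⟨j, by simpa using h⟩

end BoundedProducts

section EfronStein

variable {ι Ω : Type*} [DecidableEq ι] [Fintype Ω]

/-- The part of `F` not depending on coordinate `i` (at `false`) and the remainder
(at `true`). -/
def coordPart (ν : Ω → ℝ) (F : (ι → Ω) → ℝ) (i : ι) : Bool → (ι → Ω) → ℝ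
  | false, x => ∑ a, ν a * F (Function.update x i a)
  | true, x => F x - ∑ a, ν a * F (Function.update x i a)

lemma coordPart_false_update (ν : Ω → ℝ) (F : (ι → Ω) → ℝ) (i : ι) (x : ι → Ω) (a : Ω) :
    coordPart ν F i false (Function.update x i a) = coordPart ν F i false x := by
  simp [coordPart]

lemma abs_coordPart_le (ν : Ω → ℝ) (hν : ∀ a, 0 ≤ ν a) (hν1 : ∑ a, ν a = 1)
    (F : (ι → Ω) → ℝ) (hF : ∀ x, |F x| ≤ 1) (i : ι) (b : Bool) (x : ι → Ω) :
    |coordPart ν F i b x| ≤ 2 := by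
  have h : |∑ a, ν a * F (Function.update x i a)| ≤ 1 := by
    rw [← hν1]
    refine (Finset.abs_sum_le_sum_abs _ _).trans (Finset.sum_le_sum fun a _ => ?_)
    rw [abs_mul, abs_of_nonneg (hν a)]
    exact mul_le_of_le_one_right (hν a) (hF _)
  cases b
  · exact h.trans one_le_two
  · exact (abs_sub _ _).trans (by linarith [hF x])

lemma prod_eq_sum_coordPart {κ : Type*} [Fintype κ] [DecidableEq κ] (ν : Ω → ℝ)
    (F : (ι → Ω) → ℝ) (i : ι) (x : κ → ι → Ω) :
    ∏ j, F (x j) = ∑ β : κ → Bool, ∏ j, coordPart ν F i (β j) (x j) := by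
  have h (y : ι → Ω) : F y = ∑ b : Bool, coordPart ν F i b y := by
    simp [coordPart]
  simp only [h]
  rw [Finset.prod_univ_sum, Fintype.piFinset_univ]

lemma prod_coordPart_of_all_false {κ : Type*} [Fintype κ] (ν : Ω → ℝ)
    (F : (ι → Ω) → ℝ) (i : ι) {β : κ → Bool}
    (hβ : ∀ j, β j = false) (x : κ → ι → Ω) (a : κ → Ω) :
    ∏ j, coordPart ν F i (β j) (Function.update (x j) i (a j))
      = ∏ j, coordPart ν F i (β j) (x j) :=
  Finset.prod_congr rfl fun j _ => by rw [hβ, coordPart_false_update]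

lemma prod_coordPart_of_unique_true {κ : Type*} [Fintype κ] [DecidableEq κ] (ν : Ω → ℝ)
    (F : (ι → Ω) → ℝ) (i : ι) {β : κ → Bool}
    {j : κ} (hβ : ∀ j', j' ≠ j → β j' = false) (x : κ → ι → Ω) (a : κ → Ω) :
    ∏ j, coordPart ν F i (β j) (Function.update (x j) i (a j))
      = coordPart ν F i (β j) (Function.update (x j) i (a j))
        * ∏ j' ∈ univ.erase j, coordPart ν F i (β j') (x j') := by
  rw [← Finset.mul_prod_erase _ _ (Finset.mem_univ j)]
  congr 1
  exact Finset.prod_congr rfl fun j' hj' => by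
    rw [hβ j' (Finset.ne_of_mem_erase hj'), coordPart_false_update]

end EfronStein

section CrossIndependent

lemma row_fst_update {ι κ Ω₁ Ω₂ : Type*} [DecidableEq ι] (c : ι → (κ → Ω₁) × (κ → Ω₂)) (i : ι)
    (a : (κ → Ω₁) × (κ → Ω₂)) (j : κ) :
    (fun l => (Function.update c i a l).1 j)
      = Function.update (fun l => (c l).1 j) i (a.1 j) := by
  ext l
  by_cases h : l = i
  · subst h; simp
  · simp [h]

lemma row_snd_update {ι κ Ω₁ Ω₂ : Type*} [DecidableEq ι] (c : ι → (κ → Ω₁) × (κ → Ω₂)) (i : ι)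
    (a : (κ → Ω₁) × (κ → Ω₂)) (j : κ) :
    (fun l => (Function.update c i a l).2 j)
      = Function.update (fun l => (c l).2 j) i (a.2 j) := by
  ext l
  by_cases h : l = i
  · subst h; simp
  · simp [h]

variable {κ Ω₁ Ω₂ : Type*} [Fintype κ] [DecidableEq κ] [Fintype Ω₁] [Fintype Ω₂]
  [DecidableEq Ω₁] [DecidableEq Ω₂]

/-- `u` is a probability weight on `Ω₁^κ × Ω₂^κ` with coordinate marginals `ν₁`, `ν₂`, under
which every coordinate of the first block is independent of every one of the second. -/
structure IsCrossIndependent (ν₁ : Ω₁ → ℝ) (ν₂ : Ω₂ → ℝ) (u : (κ → Ω₁) × (κ → Ω₂) → ℝ) :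
    Prop where
  nonneg : ∀ p, 0 ≤ u p
  sum_eq_one : ∑ p, u p = 1
  fst : ∀ j a, ∑ p ∈ univ.filter (fun p => p.1 j = a), u p = ν₁ a
  snd : ∀ j b, ∑ p ∈ univ.filter (fun p => p.2 j = b), u p = ν₂ b
  pair : ∀ i j a b, ∑ p ∈ univ.filter (fun p => p.1 i = a ∧ p.2 j = b), u p = ν₁ a * ν₂ b

variable {ν₁ : Ω₁ → ℝ} {ν₂ : Ω₂ → ℝ}

lemma IsCrossIndependent.pair_fiber {u : (κ → Ω₁) × (κ → Ω₂) → ℝ}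
    (hu : IsCrossIndependent ν₁ ν₂ u) (i j : κ) (d : Ω₁ × Ω₂) :
    ∑ p ∈ univ.filter (fun p : (κ → Ω₁) × (κ → Ω₂) => (p.1 i, p.2 j) = d), u p
      = ν₁ d.1 * ν₂ d.2 := by
  rw [← hu.pair i j]
  simp only [Prod.ext_iff]

lemma IsCrossIndependent.sum_pair {u : (κ → Ω₁) × (κ → Ω₂) → ℝ}
    (hu : IsCrossIndependent ν₁ ν₂ u) (i j : κ) (Φ : Ω₁ × Ω₂ → ℝ) :
    ∑ p, u p * Φ (p.1 i, p.2 j) = ∑ d : Ω₁ × Ω₂, ν₁ d.1 * ν₂ d.2 * Φ d :=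
  sum_mul_comp_of_fiber u (fun d : Ω₁ × Ω₂ => ν₁ d.1 * ν₂ d.2) (fun p => (p.1 i, p.2 j))
    (hu.pair_fiber i j) Φ

variable {ι : Type*} [Fintype ι] [DecidableEq ι]

lemma prodExpect_fst {w : ι → (κ → Ω₁) × (κ → Ω₂) → ℝ}
    (hw : ∀ i, IsCrossIndependent ν₁ ν₂ (w i)) (j : κ) (P : (ι → Ω₁) → ℝ) :
    prodExpect w (fun c => P (fun l => (c l).1 j)) = prodExpect (fun _ => ν₁) P :=
  prodExpect_comp w ν₁ (fun p => p.1 j) (fun i => (hw i).fst j) P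

lemma prodExpect_snd {w : ι → (κ → Ω₁) × (κ → Ω₂) → ℝ}
    (hw : ∀ i, IsCrossIndependent ν₁ ν₂ (w i)) (j : κ) (Q : (ι → Ω₂) → ℝ) :
    prodExpect w (fun c => Q (fun l => (c l).2 j)) = prodExpect (fun _ => ν₂) Q :=
  prodExpect_comp w ν₂ (fun p => p.2 j) (fun i => (hw i).snd j) Q

lemma prodExpect_fst_mul_snd {w : ι → (κ → Ω₁) × (κ → Ω₂) → ℝ}
    (hw : ∀ i, IsCrossIndependent ν₁ ν₂ (w i)) (i j : κ) (P : (ι → Ω₁) → ℝ)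
    (Q : (ι → Ω₂) → ℝ) :
    prodExpect w (fun c => P (fun l => (c l).1 i) * Q (fun l => (c l).2 j))
      = prodExpect (fun _ => ν₁) P * prodExpect (fun _ => ν₂) Q := by
  rw [← prodExpect_prod]
  exact prodExpect_comp w (fun d : Ω₁ × Ω₂ => ν₁ d.1 * ν₂ d.2) (fun p => (p.1 i, p.2 j))
    (fun l => (hw l).pair_fiber i j)
    (fun z => P (fun l => (z l).1) * Q (fun l => (z l).2))

/-- One term of the expansion of `∏ j, F (x j) * ∏ j, G (y j)` around coordinate `i`. -/
def crossTerm (ν₁ : Ω₁ → ℝ) (ν₂ : Ω₂ → ℝ) (F : (ι → Ω₁) → ℝ) (G : (ι → Ω₂) → ℝ) (i : ι)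
    (β γ : κ → Bool) (c : ι → (κ → Ω₁) × (κ → Ω₂)) : ℝ :=
  (∏ j, coordPart ν₁ F i (β j) (fun l => (c l).1 j))
    * ∏ j, coordPart ν₂ G i (γ j) (fun l => (c l).2 j)

lemma abs_prodExpect_crossTerm_le_of_two_fst
    {F : (ι → Ω₁) → ℝ} {G : (ι → Ω₂) → ℝ} {i : ι}
    (hF : ∀ b x, |coordPart ν₁ F i b x| ≤ 2) (hG : ∀ b y, |coordPart ν₂ G i b y| ≤ 2)
    {w : ι → (κ → Ω₁) × (κ → Ω₂) → ℝ} (hw : ∀ l, IsCrossIndependent ν₁ ν₂ (w l))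
    {f g : ℝ} (hf : prodExpect (fun _ => ν₁) (fun x => coordPart ν₁ F i true x ^ 2) = f)
    (hg : prodExpect (fun _ => ν₂) (fun y => coordPart ν₂ G i true y ^ 2) = g)
    {β γ : κ → Bool} {j j' l : κ} (hne : j' ≠ j) (hj : β j = true) (hj' : β j' = true)
    (hl : γ l = true) :
    |prodExpect w (crossTerm ν₁ ν₂ F G i β γ)|
      ≤ 4 ^ Fintype.card κ / 8 * (√(f * g) * √f) := by
  refine abs_prodExpect_le w (fun l => (hw l).nonneg)
    (a := fun c => coordPart ν₁ F i true (fun m => (c m).1 j)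
      * coordPart ν₂ G i true (fun m => (c m).2 l))
    (b := fun c => coordPart ν₁ F i true (fun m => (c m).1 j')) (by positivity)
    (fun c => ?_) ?_ ?_
  · have h1 := abs_prod_le_two_factors
      (fun j => coordPart ν₁ F i (β j) (fun m => (c m).1 j)) (fun j => hF _ _) hne
    have h2 := abs_prod_le_one_factor
      (fun j => coordPart ν₂ G i (γ j) (fun m => (c m).2 j)) (fun j => hG _ _) l
    simp only [hj, hj', hl] at h1 h2
    rw [crossTerm, abs_mul, abs_mul]
    refine (mul_le_mul h1 h2 (abs_nonneg _) (by positivity)).trans_eq ?_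
    rw [show (4 : ℝ) = 2 * 2 by norm_num, mul_pow]
    ring
  · rw [← hf, ← hg, ← prodExpect_fst_mul_snd hw j l]
    simp only [mul_pow]
  · rw [← hf, ← prodExpect_fst hw j']

lemma abs_prodExpect_crossTerm_le_of_two_snd
    {F : (ι → Ω₁) → ℝ} {G : (ι → Ω₂) → ℝ} {i : ι}
    (hF : ∀ b x, |coordPart ν₁ F i b x| ≤ 2) (hG : ∀ b y, |coordPart ν₂ G i b y| ≤ 2)
    {w : ι → (κ → Ω₁) × (κ → Ω₂) → ℝ} (hw : ∀ l, IsCrossIndependent ν₁ ν₂ (w l))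
    {f g : ℝ} (hf : prodExpect (fun _ => ν₁) (fun x => coordPart ν₁ F i true x ^ 2) = f)
    (hg : prodExpect (fun _ => ν₂) (fun y => coordPart ν₂ G i true y ^ 2) = g)
    {β γ : κ → Bool} {j l l' : κ} (hne : l' ≠ l) (hj : β j = true) (hl : γ l = true)
    (hl' : γ l' = true) :
    |prodExpect w (crossTerm ν₁ ν₂ F G i β γ)|
      ≤ 4 ^ Fintype.card κ / 8 * (√(f * g) * √g) := by
  refine abs_prodExpect_le w (fun l => (hw l).nonneg)
    (a := fun c => coordPart ν₁ F i true (fun m => (c m).1 j)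
      * coordPart ν₂ G i true (fun m => (c m).2 l))
    (b := fun c => coordPart ν₂ G i true (fun m => (c m).2 l')) (by positivity)
    (fun c => ?_) ?_ ?_
  · have h1 := abs_prod_le_one_factor
      (fun j => coordPart ν₁ F i (β j) (fun m => (c m).1 j)) (fun j => hF _ _) j
    have h2 := abs_prod_le_two_factors
      (fun j => coordPart ν₂ G i (γ j) (fun m => (c m).2 j)) (fun j => hG _ _) hne
    simp only [hj, hl, hl'] at h1 h2
    rw [crossTerm, abs_mul, abs_mul]
    refine (mul_le_mul h1 h2 (abs_nonneg _) (by positivity)).trans_eq ?_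
    rw [show (4 : ℝ) = 2 * 2 by norm_num, mul_pow]
    ring
  · rw [← hf, ← hg, ← prodExpect_fst_mul_snd hw j l]
    simp only [mul_pow]
  · rw [← hg, ← prodExpect_snd hw l']

lemma abs_prodExpect_crossTerm_sub_le
    {F : (ι → Ω₁) → ℝ} {G : (ι → Ω₂) → ℝ} {i : ι}
    (hF : ∀ b x, |coordPart ν₁ F i b x| ≤ 2) (hG : ∀ b y, |coordPart ν₂ G i b y| ≤ 2)
    {w : ι → (κ → Ω₁) × (κ → Ω₂) → ℝ} (hw : ∀ l, IsCrossIndependent ν₁ ν₂ (w l))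
    {u : (κ → Ω₁) × (κ → Ω₂) → ℝ} (hu : IsCrossIndependent ν₁ ν₂ u)
    (hu₁ : ∀ P : (κ → Ω₁) → ℝ, ∑ p, w i p * P p.1 = ∑ p, u p * P p.1)
    (hu₂ : ∀ Q : (κ → Ω₂) → ℝ, ∑ p, w i p * Q p.2 = ∑ p, u p * Q p.2)
    {f g : ℝ} (hf : prodExpect (fun _ => ν₁) (fun x => coordPart ν₁ F i true x ^ 2) = f)
    (hg : prodExpect (fun _ => ν₂) (fun y => coordPart ν₂ G i true y ^ 2) = g)
    (β γ : κ → Bool) :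
    |prodExpect (Function.update w i u) (crossTerm ν₁ ν₂ F G i β γ)
        - prodExpect w (crossTerm ν₁ ν₂ F G i β γ)|
      ≤ 4 ^ Fintype.card κ / 4 * (√(f * g) * √f + √(f * g) * √g) := by
  have hw' : ∀ l, IsCrossIndependent ν₁ ν₂ (Function.update w i u l) := fun l => by
    by_cases h : l = i
    · subst h; simpa using hu
    · simpa [h] using hw l
  have of_eq (h : ∀ c, ∑ a, w i a * crossTerm ν₁ ν₂ F G i β γ (Function.update c i a)
      = ∑ a, u a * crossTerm ν₁ ν₂ F G i β γ (Function.update c i a)) :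
      |prodExpect (Function.update w i u) (crossTerm ν₁ ν₂ F G i β γ)
        - prodExpect w (crossTerm ν₁ ν₂ F G i β γ)|
      ≤ 4 ^ Fintype.card κ / 4 * (√(f * g) * √f + √(f * g) * √g) := by
    rw [prodExpect_update_eq w i u (hw i).sum_eq_one _ h, sub_self, abs_zero]
    positivity
  have hK : (0 : ℝ) ≤ 4 ^ Fintype.card κ := by positivity
  have hfp : 0 ≤ √(f * g) * √f := by positivity
  have hgp : 0 ≤ √(f * g) * √g := by positivity
  rcases bool_family_trichotomy β with hβ | ⟨j, hj, hβ⟩ | ⟨j, j', hne, hj, hj'⟩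
  · refine of_eq fun c => ?_
    simp only [crossTerm, row_fst_update, row_snd_update, prod_coordPart_of_all_false ν₁ F i hβ]
    exact hu₂ (fun q => _ * ∏ j, coordPart ν₂ G i (γ j)
      (Function.update (fun l => (c l).2 j) i (q j)))
  · rcases bool_family_trichotomy γ with hγ | ⟨l, hl, hγ⟩ | ⟨l, l', hne, hl, hl'⟩
    · refine of_eq fun c => ?_
      simp only [crossTerm, row_fst_update, row_snd_update,
        prod_coordPart_of_all_false ν₂ G i hγ]
      exact hu₁ (fun q => (∏ j, coordPart ν₁ F i (β j)
        (Function.update (fun l => (c l).1 j) i (q j))) * _)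
    · refine of_eq fun c => ?_
      simp only [crossTerm, row_fst_update, row_snd_update,
        prod_coordPart_of_unique_true ν₁ F i hβ, prod_coordPart_of_unique_true ν₂ G i hγ]
      let Φ : Ω₁ × Ω₂ → ℝ := fun d =>
        coordPart ν₁ F i (β j) (Function.update (fun l => (c l).1 j) i d.1)
          * (∏ j' ∈ univ.erase j, coordPart ν₁ F i (β j') (fun l => (c l).1 j'))
          * (coordPart ν₂ G i (γ l) (Function.update (fun m => (c m).2 l) i d.2)
          * ∏ j' ∈ univ.erase l, coordPart ν₂ G i (γ j') (fun m => (c m).2 j'))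
      exact ((hw i).sum_pair j l Φ).trans (hu.sum_pair j l Φ).symm
    · have h1 := abs_prodExpect_crossTerm_le_of_two_snd hF hG hw hf hg hne hj hl hl'
      have h2 := abs_prodExpect_crossTerm_le_of_two_snd hF hG hw' hf hg hne hj hl hl'
      refine (abs_sub _ _).trans ?_
      nlinarith [mul_nonneg hK hfp]
  · rcases bool_family_trichotomy γ with hγ | ⟨l, hl, -⟩ | ⟨l, -, -, hl, -⟩
    · refine of_eq fun c => ?_
      simp only [crossTerm, row_fst_update, row_snd_update,
        prod_coordPart_of_all_false ν₂ G i hγ]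
      exact hu₁ (fun q => (∏ j, coordPart ν₁ F i (β j)
        (Function.update (fun l => (c l).1 j) i (q j))) * _)
    all_goals
      have h1 := abs_prodExpect_crossTerm_le_of_two_fst hF hG hw hf hg hne hj hj' hl
      have h2 := abs_prodExpect_crossTerm_le_of_two_fst hF hG hw' hf hg hne hj hj' hl
      refine (abs_sub _ _).trans ?_
      nlinarith [mul_nonneg hK hgp]

lemma abs_prodExpect_update_sub_le
    {F : (ι → Ω₁) → ℝ} {G : (ι → Ω₂) → ℝ} {i : ι}
    (hF : ∀ b x, |coordPart ν₁ F i b x| ≤ 2) (hG : ∀ b y, |coordPart ν₂ G i b y| ≤ 2)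
    {w : ι → (κ → Ω₁) × (κ → Ω₂) → ℝ} (hw : ∀ l, IsCrossIndependent ν₁ ν₂ (w l))
    {u : (κ → Ω₁) × (κ → Ω₂) → ℝ} (hu : IsCrossIndependent ν₁ ν₂ u)
    (hu₁ : ∀ P : (κ → Ω₁) → ℝ, ∑ p, w i p * P p.1 = ∑ p, u p * P p.1)
    (hu₂ : ∀ Q : (κ → Ω₂) → ℝ, ∑ p, w i p * Q p.2 = ∑ p, u p * Q p.2)
    {f g : ℝ} (hf : prodExpect (fun _ => ν₁) (fun x => coordPart ν₁ F i true x ^ 2) = f)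
    (hg : prodExpect (fun _ => ν₂) (fun y => coordPart ν₂ G i true y ^ 2) = g) :
    |prodExpect (Function.update w i u)
          (fun c => (∏ j, F (fun l => (c l).1 j)) * ∏ j, G (fun l => (c l).2 j))
        - prodExpect w (fun c => (∏ j, F (fun l => (c l).1 j)) * ∏ j, G (fun l => (c l).2 j))|
      ≤ 16 ^ Fintype.card κ / 4 * (√(f * g) * √f + √(f * g) * √g) := by
  classical
  have hexp : (fun c : ι → (κ → Ω₁) × (κ → Ω₂) =>
      (∏ j, F (fun l => (c l).1 j)) * ∏ j, G (fun l => (c l).2 j))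
      = fun c => ∑ p : (κ → Bool) × (κ → Bool), crossTerm ν₁ ν₂ F G i p.1 p.2 c := by
    funext c
    rw [prod_eq_sum_coordPart ν₁ F i, prod_eq_sum_coordPart ν₂ G i, Finset.sum_mul_sum,
      ← Finset.sum_product', Finset.univ_product_univ]
    rfl
  rw [hexp, prodExpect_sum, prodExpect_sum, ← Finset.sum_sub_distrib]
  refine (Finset.abs_sum_le_sum_abs _ _).trans
    ((Finset.sum_le_sum fun p _ =>
      abs_prodExpect_crossTerm_sub_le hF hG hw hu hu₁ hu₂ hf hg p.1 p.2).trans_eq ?_)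
  rw [Finset.sum_const, nsmul_eq_mul, Finset.card_univ, Fintype.card_prod, Fintype.card_fun,
    Fintype.card_bool]
  push_cast
  rw [← mul_pow, ← mul_assoc, ← mul_div_assoc, ← mul_pow]
  norm_num

lemma abs_prodExpect_hybrid_sub_le (Φ : (ι → (κ → Ω₁) × (κ → Ω₂)) → ℝ)
    {m u : (κ → Ω₁) × (κ → Ω₂) → ℝ} (hm : IsCrossIndependent ν₁ ν₂ m)
    (hu : IsCrossIndependent ν₁ ν₂ u) (δ : ι → ℝ)
    (hδ : ∀ (w : ι → (κ → Ω₁) × (κ → Ω₂) → ℝ) (i : ι),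
      (∀ l, IsCrossIndependent ν₁ ν₂ (w l)) → w i = m →
      |prodExpect (Function.update w i u) Φ - prodExpect w Φ| ≤ δ i) :
    |prodExpect (fun _ => m) Φ - prodExpect (fun _ => u) Φ| ≤ ∑ i, δ i := by
  have key (s : Finset ι) :
      |prodExpect (fun l => if l ∈ s then u else m) Φ - prodExpect (fun _ => m) Φ|
        ≤ ∑ i ∈ s, δ i := by
    induction s using Finset.induction_on with
    | empty => simp
    | insert i s hi ih =>
      have hupd : (fun l => if l ∈ insert i s then u else m)
          = Function.update (fun l => if l ∈ s then u else m) i u := by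
        funext l
        by_cases h : l = i
        · subst h; simp
        · simp [h]
      rw [Finset.sum_insert hi, hupd]
      refine (abs_sub_le _ (prodExpect (fun l => if l ∈ s then u else m) Φ) _).trans
        (add_le_add (hδ _ i (fun l => ?_) (by simp [hi])) ih)
      by_cases h : l ∈ s <;> simp [h, hm, hu]
  rw [abs_sub_comm]
  simpa using key univ

end CrossIndependent

lemma isCrossIndependent_prod {κ Ω₁ Ω₂ : Type*} [Fintype κ] [DecidableEq κ] [Fintype Ω₁]
    [Fintype Ω₂] [DecidableEq Ω₁] [DecidableEq Ω₂] {ν₁ : Ω₁ → ℝ} {ν₂ : Ω₂ → ℝ}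
    {μ : (κ → Ω₁) × (κ → Ω₂) → ℝ} (hμ : IsCrossIndependent ν₁ ν₂ μ) :
    IsCrossIndependent ν₁ ν₂
      (fun p : (κ → Ω₁) × (κ → Ω₂) => (∑ y, μ (p.1, y)) * ∑ x, μ (x, p.2)) := by
  have h1 : ∑ x, ∑ y, μ (x, y) = 1 := by rw [← Fintype.sum_prod_type]; exact hμ.sum_eq_one
  have h2 : ∑ y, ∑ x, μ (x, y) = 1 := by rw [Finset.sum_comm]; exact h1
  have hA (j : κ) (a : Ω₁) : ∑ x, (if x j = a then ∑ y, μ (x, y) else 0) = ν₁ a := by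
    rw [← hμ.fst j a, Finset.sum_filter, Fintype.sum_prod_type]
    refine Finset.sum_congr rfl fun x _ => ?_
    split_ifs <;> simp
  have hB (j : κ) (b : Ω₂) : ∑ y, (if y j = b then ∑ x, μ (x, y) else 0) = ν₂ b := by
    rw [← hμ.snd j b, Finset.sum_filter, Fintype.sum_prod_type_right]
    refine Finset.sum_congr rfl fun y _ => ?_
    split_ifs <;> simp
  refine ⟨fun p => mul_nonneg (Finset.sum_nonneg fun _ _ => hμ.nonneg _)
    (Finset.sum_nonneg fun _ _ => hμ.nonneg _), ?_, fun j a => ?_, fun j b => ?_,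
    fun i j a b => ?_⟩
  · rw [Fintype.sum_prod_type]
    dsimp only
    rw [← Finset.sum_mul_sum, h1, h2, one_mul]
  · rw [Finset.sum_filter, Fintype.sum_prod_type, ← hA j a]
    refine Finset.sum_congr rfl fun x _ => ?_
    by_cases hx : x j = a <;> simp [hx, ← Finset.mul_sum, h2]
  · rw [Finset.sum_filter, Fintype.sum_prod_type_right, ← hB j b]
    refine Finset.sum_congr rfl fun y _ => ?_
    by_cases hy : y j = b <;> simp [hy, ← Finset.sum_mul, h1]
  · rw [Finset.sum_filter, Fintype.sum_prod_type, ← hA i a, ← hB j b, Finset.sum_mul_sum]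
    refine Finset.sum_congr rfl fun x _ => Finset.sum_congr rfl fun y _ => ?_
    by_cases hx : x i = a <;> by_cases hy : y j = b <;> simp [hx, hy]

/-- invariance principle for correlated spaces: let `μ` be a distribution on
`Ω₁^k × Ω₂^k` whose marginal on any pair of coordinates, one from each block, is a product
distribution, all `Ω₁`-coordinate marginals being `ν₁` and all `Ω₂`-coordinate marginals
being `ν₂`; let `μ₁, μ₂` be its marginals on the two blocks.  Draw `k × L` matrices `X, Y`
by drawing each column pair independently from `μ`.  For `F : Ω₁^L → [-1,1]` and
`G : Ω₂^L → [-1,1]` with influences (w.r.t. `ν₁^{⊗L}`, `ν₂^{⊗L}`; the influence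
`Inf_i = Σ_{β ∋ i} ‖·_β‖²` equals the expected conditional variance in coordinate `i`),
and `τ, Γ` as below, the expectation of `Π_j F(x_j) G(y_j)` differs from the product of the
expectations of `Π_j F(x_j)` and `Π_j G(y_j)` by at most `2^{4k+1} Γ τ`. -/
theorem stmt_8 (k Ln : ℕ) (hk : 1 ≤ k) (hL : 1 ≤ Ln)
    {Ω₁ Ω₂ : Type} [Fintype Ω₁] [Fintype Ω₂] [DecidableEq Ω₁] [DecidableEq Ω₂]
    [Nonempty Ω₁] [Nonempty Ω₂]
    (μ : ((Fin k → Ω₁) × (Fin k → Ω₂)) → ℝ)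
    (hμ0 : ∀ p, 0 ≤ μ p) (hμ1 : ∑ p, μ p = 1)
    (ν₁ : Ω₁ → ℝ) (ν₂ : Ω₂ → ℝ)
    (hν₁ : ∀ (j : Fin k) (a : Ω₁), ∑ p ∈ univ.filter (fun p => p.1 j = a), μ p = ν₁ a)
    (hν₂ : ∀ (j : Fin k) (b : Ω₂), ∑ p ∈ univ.filter (fun p => p.2 j = b), μ p = ν₂ b)
    (hpair : ∀ (i j : Fin k) (a : Ω₁) (b : Ω₂),
      ∑ p ∈ univ.filter (fun p => p.1 i = a ∧ p.2 j = b), μ p = ν₁ a * ν₂ b)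
    (μ₁ : (Fin k → Ω₁) → ℝ) (μ₂ : (Fin k → Ω₂) → ℝ)
    (hμ₁ : ∀ x, μ₁ x = ∑ y, μ (x, y)) (hμ₂ : ∀ y, μ₂ y = ∑ x, μ (x, y))
    (F : (Fin Ln → Ω₁) → ℝ) (G : (Fin Ln → Ω₂) → ℝ)
    (hF : ∀ x, F x ∈ Set.Icc (-1 : ℝ) 1) (hG : ∀ y, G y ∈ Set.Icc (-1 : ℝ) 1)
    (InfF InfG : Fin Ln → ℝ)
    (hInfF : ∀ i, InfF i = ∑ x : Fin Ln → Ω₁, (∏ l, ν₁ (x l)) *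
        (F x - ∑ a, ν₁ a * F (Function.update x i a)) ^ 2)
    (hInfG : ∀ i, InfG i = ∑ y : Fin Ln → Ω₂, (∏ l, ν₂ (y l)) *
        (G y - ∑ b, ν₂ b * G (Function.update y i b)) ^ 2)
    (τ Γ : ℝ)
    (hτ : τ = Real.sqrt (∑ i, InfF i * InfG i))
    (hΓ : Γ = max (Real.sqrt (∑ i, InfF i)) (Real.sqrt (∑ i, InfG i))) :
    |(∑ cols : Fin Ln → (Fin k → Ω₁) × (Fin k → Ω₂),
        (∏ i, μ (cols i)) *
          ((∏ j, F (fun i => (cols i).1 j)) * (∏ j, G (fun i => (cols i).2 j))))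
      - (∑ X : Fin Ln → (Fin k → Ω₁), (∏ i, μ₁ (X i)) * ∏ j, F (fun i => X i j))
        * (∑ Y : Fin Ln → (Fin k → Ω₂), (∏ i, μ₂ (Y i)) * ∏ j, G (fun i => Y i j))|
      ≤ 2 ^ (4 * k + 1) * Γ * τ := by
  have hν₁0 (a : Ω₁) : 0 ≤ ν₁ a := hν₁ ⟨0, hk⟩ a ▸ Finset.sum_nonneg fun p _ => hμ0 p
  have hν₂0 (b : Ω₂) : 0 ≤ ν₂ b := hν₂ ⟨0, hk⟩ b ▸ Finset.sum_nonneg fun p _ => hμ0 p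
  have hν₁1 : ∑ a, ν₁ a = 1 := by
    rw [← hμ1, ← Finset.sum_fiberwise univ (fun p => p.1 ⟨0, hk⟩) μ]
    exact Finset.sum_congr rfl fun a _ => (hν₁ ⟨0, hk⟩ a).symm
  have hν₂1 : ∑ b, ν₂ b = 1 := by
    rw [← hμ1, ← Finset.sum_fiberwise univ (fun p => p.2 ⟨0, hk⟩) μ]
    exact Finset.sum_congr rfl fun b _ => (hν₂ ⟨0, hk⟩ b).symm
  have hμ : IsCrossIndependent ν₁ ν₂ μ := ⟨hμ0, hμ1, hν₁, hν₂, hpair⟩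
  have hprod : IsCrossIndependent ν₁ ν₂ (fun p => μ₁ p.1 * μ₂ p.2) := by
    simp only [hμ₁, hμ₂]
    exact isCrossIndependent_prod hμ
  have hμ₁1 : ∑ x, μ₁ x = 1 := by
    simp only [hμ₁]
    rw [← Fintype.sum_prod_type]; exact hμ1
  have hμ₂1 : ∑ y, μ₂ y = 1 := by
    simp only [hμ₂]
    rw [Finset.sum_comm, ← Fintype.sum_prod_type]; exact hμ1
  have hm₁ (P : (Fin k → Ω₁) → ℝ) : ∑ p, μ p * P p.1 =
      ∑ p : (Fin k → Ω₁) × (Fin k → Ω₂), μ₁ p.1 * μ₂ p.2 * P p.1 := by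
    rw [Fintype.sum_prod_type, Fintype.sum_prod_type]
    refine Finset.sum_congr rfl fun x _ => ?_
    dsimp only
    rw [← Finset.sum_mul, ← Finset.sum_mul, ← hμ₁, ← Finset.mul_sum, hμ₂1, mul_one]
  have hm₂ (Q : (Fin k → Ω₂) → ℝ) : ∑ p, μ p * Q p.2 =
      ∑ p : (Fin k → Ω₁) × (Fin k → Ω₂), μ₁ p.1 * μ₂ p.2 * Q p.2 := by
    rw [Fintype.sum_prod_type_right, Fintype.sum_prod_type_right]
    refine Finset.sum_congr rfl fun y _ => ?_
    dsimp only
    rw [← Finset.sum_mul, ← Finset.sum_mul, ← hμ₂, ← Finset.sum_mul, hμ₁1, one_mul]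
  have hF2 (i : Fin Ln) := abs_coordPart_le ν₁ hν₁0 hν₁1 F (fun x => abs_le.mpr (hF x)) i
  have hG2 (i : Fin Ln) := abs_coordPart_le ν₂ hν₂0 hν₂1 G (fun y => abs_le.mpr (hG y)) i
  have hf (i : Fin Ln) :
      prodExpect (fun _ => ν₁) (fun x => coordPart ν₁ F i true x ^ 2) = InfF i :=
    (hInfF i).symm
  have hg (i : Fin Ln) :
      prodExpect (fun _ => ν₂) (fun y => coordPart ν₂ G i true y ^ 2) = InfG i :=
    (hInfG i).symm
  have hf0 (i : Fin Ln) : 0 ≤ InfF i := hInfF i ▸ Finset.sum_nonneg fun x _ =>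
    mul_nonneg (Finset.prod_nonneg fun l _ => hν₁0 _) (sq_nonneg _)
  have hg0 (i : Fin Ln) : 0 ≤ InfG i := hInfG i ▸ Finset.sum_nonneg fun y _ =>
    mul_nonneg (Finset.prod_nonneg fun l _ => hν₂0 _) (sq_nonneg _)
  have hswap := abs_prodExpect_hybrid_sub_le (ι := Fin Ln)
    (fun c => (∏ j, F (fun l => (c l).1 j)) * ∏ j, G (fun l => (c l).2 j)) hμ hprod
    (fun i => 16 ^ k / 4 * (√(InfF i * InfG i) * √(InfF i) + √(InfF i * InfG i) * √(InfG i)))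
    (fun w i hw hwi => by
      simpa using abs_prodExpect_update_sub_le (hF2 i) (hG2 i) hw hprod
        (by rw [hwi]; exact hm₁) (by rw [hwi]; exact hm₂) (hf i) (hg i))
  have hfactor := prodExpect_prod (ι := Fin Ln) μ₁ μ₂
    (fun X => ∏ j, F (fun l => X l j)) (fun Y => ∏ j, G (fun l => Y l j))
  rw [hfactor] at hswap
  refine le_trans hswap ?_
  have hfg0 (i : Fin Ln) : 0 ≤ InfF i * InfG i := mul_nonneg (hf0 i) (hg0 i)
  have hτ0 : 0 ≤ τ := hτ ▸ Real.sqrt_nonneg _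
  have hsF : ∑ i, √(InfF i * InfG i) * √(InfF i) ≤ τ * Γ := by
    refine (Real.sum_sqrt_mul_sqrt_le _ hfg0 hf0).trans ?_
    rw [← hτ, hΓ]
    exact mul_le_mul_of_nonneg_left (le_max_left _ _) hτ0
  have hsG : ∑ i, √(InfF i * InfG i) * √(InfG i) ≤ τ * Γ := by
    refine (Real.sum_sqrt_mul_sqrt_le _ hfg0 hg0).trans ?_
    rw [← hτ, hΓ]
    exact mul_le_mul_of_nonneg_left (le_max_right _ _) hτ0
  have hΓτ : 0 ≤ τ * Γ := mul_nonneg hτ0 (hΓ ▸ (Real.sqrt_nonneg _).trans (le_max_left _ _))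
  have h16 : (2 : ℝ) ^ (4 * k + 1) = 2 * 16 ^ k := by
    rw [pow_succ, pow_mul]; norm_num [mul_comm]
  have hK : (0 : ℝ) ≤ 16 ^ k := by positivity
  rw [← Finset.mul_sum, Finset.sum_add_distrib, h16]
  nlinarith [mul_le_mul_of_nonneg_left (add_le_add hsF hsG) hK, mul_nonneg hK hΓτ]
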